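/- Define for a unit vector n ∈ ℝ³ and a uniformly distributed unit vector λ ∈ S² the value v(A) = a₀ + |a| if (λ + n)·a > 0 and v(A) = a₀ − |a| if (λ + n)·a < 0, for A = a₀𝟙 + a·σ. Then the average of v(A) over the uniform measure on the sphere S² equals a₀ + a·n, which is the quantum expectation ⟨+n|A|+n⟩ in the eigenstate |+n⟩ of n·σ with eigenvalue +1. -/

import Mathlib

open Matrix MeasureTheory Metric
open scoped RealInnerProductSpace

noncomputable section

def pauli : Fin 3 → Matrix (Fin 2) (Fin 2) ℂ
  | 0 => !![0, 1; 1, 0]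
  | 1 => !![0, -Complex.I; Complex.I, 0]
  | 2 => !![1, 0; 0, -1]

def dotPauli (a : EuclideanSpace ℝ (Fin 3)) : Matrix (Fin 2) (Fin 2) ℂ :=
  ∑ i, (a i : ℂ) • pauli i

/-- Bell's hidden-variable value assignment for A = a₀𝟙 + a·σ:
v(A) = a₀ + |a| if (λ+n)·a > 0, and a₀ − |a| otherwise. -/
def v (a₀ : ℝ) (a n : EuclideanSpace ℝ (Fin 3))
    (l : sphere (0 : EuclideanSpace ℝ (Fin 3)) 1) : ℝ :=
  if 0 < ⟪(l : EuclideanSpace ℝ (Fin 3)) + n, a⟫ then a₀ + ‖a‖ else a₀ - ‖a‖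

/-- The surface (uniform, unnormalized) measure on the unit sphere S² ⊂ ℝ³;
its total mass is 4π. -/
def μS : Measure (sphere (0 : EuclideanSpace ℝ (Fin 3)) 1) :=
  (volume : Measure (EuclideanSpace ℝ (Fin 3))).toSphere

theorem exists_measurePreserving_inner_eq_fst (e : EuclideanSpace ℝ (Fin 3)) (he : ‖e‖ = 1) :
    ∃ f : EuclideanSpace ℝ (Fin 3) → ℝ × EuclideanSpace ℝ (Fin 2),
      MeasurePreserving f volume volume ∧
      ∀ x, (f x).1 = ⟪x, e⟫ ∧ (f x).1 ^ 2 + ‖(f x).2‖ ^ 2 = ‖x‖ ^ 2 := by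
  have ho : Orthonormal ℝ (({0} : Set (Fin 3)).domRestrict fun _ => e) := by
    refine ⟨fun _ => he, fun i j hij => (hij (Subsingleton.elim i j)).elim⟩
  obtain ⟨b, hb⟩ := ho.exists_orthonormalBasis_extension_of_card_eq (by simp)
  have hb0 : b 0 = e := hb 0 rfl
  have h1 := b.measurePreserving_repr
  have h2 := PiLp.volume_preserving_ofLp (Fin 3)
  have h3 := volume_preserving_piFinSuccAbove (fun _ : Fin 3 => ℝ) 0
  have h4 := (MeasurePreserving.id (volume : Measure ℝ)).prod (PiLp.volume_preserving_toLp (Fin 2))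
  refine ⟨_, h4.comp (h3.comp (h2.comp h1)), fun x => ?_⟩
  have hfst : b.repr x 0 = ⟪x, e⟫ := by rw [b.repr_apply_apply, hb0, real_inner_comm]
  refine ⟨hfst, ?_⟩
  rw [← b.repr.norm_map x, EuclideanSpace.norm_sq_eq, EuclideanSpace.norm_sq_eq,
    Fin.sum_univ_three, Fin.sum_univ_two]
  simp [MeasurableEquiv.piFinSuccAbove, Fin.insertNthEquiv, Fin.tail, add_assoc]

theorem mul_norm_lt_iff {t s r : ℝ} (ht : 0 < t) (hr : 0 ≤ r) :
    t * r < s ↔ 0 < s ∧ t ^ 2 * r ^ 2 < s ^ 2 := by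
  rw [← mul_pow]
  have h0 : 0 ≤ t * r := by positivity
  constructor
  · intro h
    exact ⟨by linarith, by gcongr⟩
  · rintro ⟨hs, h⟩
    exact lt_of_pow_lt_pow_left₀ 2 hs.le h

/-- The open sector of the unit ball of `ℝ × ℝ²` cut out by the cone around the first axis whose
half-angle has cosine `t`. -/
def sphericalSector (t : ℝ) : Set (ℝ × EuclideanSpace ℝ (Fin 2)) :=
  {p | p.1 ^ 2 + ‖p.2‖ ^ 2 < 1 ∧ 0 < p.1 ∧ t ^ 2 * (p.1 ^ 2 + ‖p.2‖ ^ 2) < p.1 ^ 2}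

theorem measurableSet_sphericalSector (t : ℝ) : MeasurableSet (sphericalSector t) := by
  have h1 : IsOpen {p : ℝ × EuclideanSpace ℝ (Fin 2) | p.1 ^ 2 + ‖p.2‖ ^ 2 < 1} :=
    isOpen_lt (by fun_prop) (by fun_prop)
  have h2 : IsOpen {p : ℝ × EuclideanSpace ℝ (Fin 2) | 0 < p.1} :=
    isOpen_lt (by fun_prop) (by fun_prop)
  have h3 : IsOpen {p : ℝ × EuclideanSpace ℝ (Fin 2) |
      t ^ 2 * (p.1 ^ 2 + ‖p.2‖ ^ 2) < p.1 ^ 2} :=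
    isOpen_lt (by fun_prop) (by fun_prop)
  exact (h1.inter (h2.inter h3)).measurableSet

theorem volume_sphericalSector {t : ℝ} (ht : 0 < t) (ht1 : t ≤ 1) :
    volume (sphericalSector t) = ENNReal.ofReal (2 * Real.pi / 3 * (1 - t)) := by
  set g : ℝ → ℝ := fun s => Real.pi * min (1 - s ^ 2) (s ^ 2 * (1 / t ^ 2 - 1)) with hg
  have hgc : Continuous g := by fun_prop
  have hk : 0 ≤ 1 / t ^ 2 - 1 := by
    rw [sub_nonneg, le_div_iff₀ (by positivity)]
    nlinarith
  rw [Measure.volume_eq_prod, Measure.prod_apply (measurableSet_sphericalSector t)]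
  have hslice : ∀ s : ℝ, volume (Prod.mk s ⁻¹' sphericalSector t) =
      (Set.Ioc (0 : ℝ) 1).indicator (fun s => ENNReal.ofReal (g s)) s := by
    intro s
    by_cases hs : s ∈ Set.Ioc (0 : ℝ) 1
    · rw [Set.indicator_of_mem hs]
      have hm : 0 ≤ min (1 - s ^ 2) (s ^ 2 * (1 / t ^ 2 - 1)) :=
        le_min (by nlinarith [hs.1, hs.2]) (by positivity)
      have hset : Prod.mk s ⁻¹' sphericalSector t =
          ball 0 √(min (1 - s ^ 2) (s ^ 2 * (1 / t ^ 2 - 1))) := by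
        ext y
        have h2 : t ^ 2 * (s ^ 2 + ‖y‖ ^ 2) < s ^ 2 ↔ ‖y‖ ^ 2 < s ^ 2 * (1 / t ^ 2 - 1) := by
          rw [← lt_div_iff₀' (by positivity)]
          constructor <;> intro h <;> ring_nf at h ⊢ <;> linarith
        rw [mem_ball_zero_iff, Real.lt_sqrt (norm_nonneg y), lt_min_iff, ← h2]
        simp only [Set.mem_preimage, sphericalSector, Set.mem_ofPred_eq, hs.1, true_and]
        exact and_congr_left fun _ => by constructor <;> intro h <;> linarith
      rw [hset, EuclideanSpace.volume_ball_fin_two, ← ENNReal.ofReal_pow (Real.sqrt_nonneg _),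
        Real.sq_sqrt hm, ← ENNReal.ofReal_mul hm, mul_comm]
    · rw [Set.indicator_of_notMem hs]
      convert measure_empty (μ := (volume : Measure (EuclideanSpace ℝ (Fin 2))))
      refine Set.eq_empty_of_forall_notMem fun y hy => hs ⟨hy.2.1, ?_⟩
      have := hy.1
      simp only at this
      nlinarith [sq_nonneg ‖y‖]
  simp_rw [hslice]
  rw [lintegral_indicator measurableSet_Ioc, ← ofReal_integral_eq_lintegral_ofReal]
  rotate_left
  · exact hgc.integrableOn_Ioc
  · filter_upwards [ae_restrict_mem measurableSet_Ioc] with s hs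
    exact mul_nonneg Real.pi_pos.le (le_min (by nlinarith [hs.1, hs.2]) (by positivity))
  rw [← intervalIntegral.integral_of_le zero_le_one,
    ← intervalIntegral.integral_add_adjacent_intervals (hgc.intervalIntegrable 0 t)
      (hgc.intervalIntegrable t 1)]
  have i1 : ∫ s in (0 : ℝ)..t, g s = ∫ s in (0 : ℝ)..t, Real.pi * (s ^ 2 * (1 / t ^ 2 - 1)) := by
    refine intervalIntegral.integral_congr fun s hs => ?_
    rw [Set.uIcc_of_le ht.le] at hs
    simp only [hg]
    rw [min_eq_right]
    have : s ^ 2 / t ^ 2 ≤ 1 := by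
      rw [div_le_one (by positivity)]
      nlinarith [hs.1, hs.2]
    ring_nf at this ⊢
    linarith
  have i2 : ∫ s in t..1, g s = ∫ s in t..1, Real.pi * (1 - s ^ 2) := by
    refine intervalIntegral.integral_congr fun s hs => ?_
    rw [Set.uIcc_of_le ht1] at hs
    simp only [hg]
    rw [min_eq_left]
    have : 1 ≤ s ^ 2 / t ^ 2 := by
      rw [one_le_div (by positivity)]
      nlinarith [hs.1, hs.2]
    ring_nf at this ⊢
    linarith
  rw [i1, i2]
  congr 1
  simp only [intervalIntegral.integral_const_mul, intervalIntegral.integral_mul_const]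
  rw [intervalIntegral.integral_sub (by simp) (by simp)]
  simp only [integral_pow, intervalIntegral.integral_const, smul_eq_mul]
  field_simp
  ring

instance : IsFiniteMeasure μS := inferInstanceAs (IsFiniteMeasure (Measure.toSphere _))

theorem μS_real_univ : μS.real Set.univ = 4 * Real.pi := by
  rw [μS, Measure.toSphere_real_apply_univ, Measure.real, EuclideanSpace.volume_ball_fin_three]
  rw [ENNReal.toReal_mul, ENNReal.toReal_ofReal (by positivity)]
  simp
  ring

/-- The open spherical cap of points whose component along `e` exceeds `t`. -/
def openCap (e : EuclideanSpace ℝ (Fin 3)) (t : ℝ) :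
    Set (sphere (0 : EuclideanSpace ℝ (Fin 3)) 1) :=
  {l | t < ⟪(l : EuclideanSpace ℝ (Fin 3)), e⟫}

theorem measurableSet_openCap (e : EuclideanSpace ℝ (Fin 3)) (t : ℝ) :
    MeasurableSet (openCap e t) :=
  (isOpen_lt (by fun_prop) (by fun_prop)).measurableSet

open scoped Pointwise in
theorem μS_real_openCap_of_pos {e : EuclideanSpace ℝ (Fin 3)} (he : ‖e‖ = 1) {t : ℝ}
    (ht : 0 < t) (ht1 : t ≤ 1) :
    μS.real (openCap e t) = 2 * Real.pi * (1 - t) := by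
  obtain ⟨f, hf, hfx⟩ := exists_measurePreserving_inner_eq_fst e he
  have hset : Set.Ioo (0 : ℝ) 1 •
      ((Subtype.val : sphere (0 : EuclideanSpace ℝ (Fin 3)) 1 → _) '' openCap e t) =
        f ⁻¹' sphericalSector t := by
    ext x
    simp only [Set.mem_preimage, sphericalSector, Set.mem_ofPred_eq, (hfx x).2]
    rw [← mul_norm_lt_iff ht (norm_nonneg x), (hfx x).1, sq_lt_one_iff₀ (norm_nonneg x)]
    constructor
    · rintro ⟨r, hr, _, ⟨l, hl, rfl⟩, rfl⟩
      have hl1 : ‖(l : EuclideanSpace ℝ (Fin 3))‖ = 1 := norm_eq_of_mem_sphere l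
      have hl' : t < ⟪(l : EuclideanSpace ℝ (Fin 3)), e⟫ := hl
      simp only [norm_smul, hl1, Real.norm_eq_abs, abs_of_pos hr.1, mul_one, real_inner_smul_left]
      exact ⟨hr.2, by nlinarith [hr.1]⟩
    · rintro ⟨h1, h2⟩
      have hx : 0 < ‖x‖ := by
        rw [norm_pos_iff]
        rintro rfl
        simp at h2
      refine ⟨‖x‖, ⟨hx, h1⟩, ‖x‖⁻¹ • x, ⟨⟨‖x‖⁻¹ • x, ?_⟩, ?_, rfl⟩, ?_⟩
      · simp [norm_smul, hx.ne']
      · simp only [openCap, Set.mem_ofPred_eq, real_inner_smul_left]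
        rwa [inv_mul_eq_div, lt_div_iff₀ hx]
      · simp [smul_smul, hx.ne']
  rw [Measure.real, μS, Measure.toSphere_apply' _ (measurableSet_openCap e t), hset,
    hf.measure_preimage (measurableSet_sphericalSector t).nullMeasurableSet,
    volume_sphericalSector ht ht1, ENNReal.toReal_mul,
    ENNReal.toReal_ofReal (mul_nonneg (by positivity) (by linarith))]
  simp
  ring

theorem μS_real_openCap_add_neg_le (e : EuclideanSpace ℝ (Fin 3)) (t : ℝ) :
    μS.real (openCap e t) + μS.real (openCap (-e) (-t)) ≤ 4 * Real.pi := by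
  rw [← μS_real_univ, ← measureReal_union _ (measurableSet_openCap _ _)]
  · exact measureReal_mono (Set.subset_univ _)
  · refine Set.disjoint_left.2 fun l h1 h2 => ?_
    simp only [openCap, Set.mem_ofPred_eq, inner_neg_right] at h1 h2
    linarith

theorem le_μS_real_openCap_add_neg (e : EuclideanSpace ℝ (Fin 3)) {t s : ℝ} (hts : t < s) :
    4 * Real.pi ≤ μS.real (openCap e t) + μS.real (openCap (-e) (-s)) := by
  rw [← μS_real_univ]
  refine le_trans (measureReal_mono fun l _ => ?_) (measureReal_union_le _ _)
  simp only [Set.mem_union, openCap, Set.mem_ofPred_eq, inner_neg_right]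
  by_contra! h
  linarith

theorem two_pi_mul_le_of_forall_lt {A t u : ℝ} (htu : t < u)
    (h : ∀ s, t < s → s < u → 2 * Real.pi * (1 - s) ≤ A) : 2 * Real.pi * (1 - t) ≤ A := by
  have hc : Filter.Tendsto (fun s : ℝ => 2 * Real.pi * (1 - s)) (nhdsWithin t (Set.Ioi t))
      (nhds (2 * Real.pi * (1 - t))) :=
    ((by fun_prop : Continuous fun s : ℝ => 2 * Real.pi * (1 - s)).tendsto t).mono_left
      nhdsWithin_le_nhds
  refine le_of_tendsto hc ?_
  filter_upwards [Ioo_mem_nhdsGT htu] with s hs using h s hs.1 hs.2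

/-- **Archimedes' hat-box theorem** for spherical caps. -/
theorem μS_real_openCap {e : EuclideanSpace ℝ (Fin 3)} (he : ‖e‖ = 1) {t : ℝ}
    (ht : -1 ≤ t) (ht1 : t ≤ 1) :
    μS.real (openCap e t) = 2 * Real.pi * (1 - t) := by
  have lower_zero : ∀ e : EuclideanSpace ℝ (Fin 3), ‖e‖ = 1 →
      2 * Real.pi * (1 - 0) ≤ μS.real (openCap e 0) := by
    refine fun e he => two_pi_mul_le_of_forall_lt zero_lt_one fun s hs hs1 => ?_
    rw [← μS_real_openCap_of_pos he hs hs1.le]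
    exact measureReal_mono fun l (hl : s < _) => hs.trans hl
  have hne : ‖-e‖ = 1 := by rwa [norm_neg]
  rcases lt_trichotomy t 0 with h | rfl | h
  · refine le_antisymm ?_ (two_pi_mul_le_of_forall_lt h fun s hs hs0 => ?_)
    · have := μS_real_openCap_add_neg_le e t
      rw [μS_real_openCap_of_pos hne (neg_pos.2 h) (by linarith)] at this
      linarith
    · have := le_μS_real_openCap_add_neg e hs
      rw [μS_real_openCap_of_pos hne (neg_pos.2 hs0) (by linarith)] at this
      linarith
  · refine le_antisymm ?_ (lower_zero e he)
    have h1 := μS_real_openCap_add_neg_le e 0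
    have h2 := lower_zero (-e) hne
    rw [neg_zero] at h1
    linarith
  · exact μS_real_openCap_of_pos he h ht1

theorem integral_v (a₀ : ℝ) (a n : EuclideanSpace ℝ (Fin 3)) (hn : ‖n‖ = 1) :
    ∫ l, v a₀ a n l ∂μS = 4 * Real.pi * (a₀ + ⟪a, n⟫) := by
  rcases eq_or_ne a 0 with rfl | ha
  · simp [v, μS_real_univ]
  have hpos : 0 < ‖a‖ := norm_pos_iff.2 ha
  set e : EuclideanSpace ℝ (Fin 3) := ‖a‖⁻¹ • a with he_def
  have he : ‖e‖ = 1 := by simp [he_def, norm_smul, hpos.ne']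
  have hae : a = ‖a‖ • e := by simp [he_def, smul_smul, hpos.ne']
  have hv : v a₀ a n = fun l => (a₀ - ‖a‖) +
      (openCap e (-⟪n, e⟫)).indicator (fun _ => 2 * ‖a‖) l := by
    funext l
    have hiff : 0 < ⟪(l : EuclideanSpace ℝ (Fin 3)) + n, a⟫ ↔
        -⟪n, e⟫ < ⟪(l : EuclideanSpace ℝ (Fin 3)), e⟫ := by
      have : ⟪(l : EuclideanSpace ℝ (Fin 3)) + n, a⟫ =
          ‖a‖ * (⟪(l : EuclideanSpace ℝ (Fin 3)), e⟫ + ⟪n, e⟫) := by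
        conv_lhs => rw [hae]
        rw [real_inner_smul_right, inner_add_left]
      rw [this, mul_pos_iff_of_pos_left hpos, neg_lt_iff_pos_add]
    simp only [v, hiff, Set.indicator_apply, openCap, Set.mem_ofPred_eq]
    split_ifs <;> ring
  have hb : |⟪n, e⟫| ≤ 1 := by simpa [hn, he] using abs_real_inner_le_norm n e
  have hin : ⟪a, n⟫ = ‖a‖ * ⟪n, e⟫ := by
    conv_lhs => rw [hae]
    rw [real_inner_smul_left, real_inner_comm]
  rw [hv, integral_add (integrable_const _)
    ((integrable_const _).indicator (measurableSet_openCap _ _)),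
    integral_indicator_const _ (measurableSet_openCap _ _), integral_const, μS_real_univ,
    μS_real_openCap he (by linarith [(abs_le.1 hb).2]) (by linarith [(abs_le.1 hb).1]), hin]
  simp only [smul_eq_mul]
  ring

theorem expectation_of_dotPauli_eigenvector (a₀ : ℝ) (a n : EuclideanSpace ℝ (Fin 3))
    (ψ : Fin 2 → ℂ) (hψ : (dotPauli n).mulVec ψ = ψ) (hnorm : (∑ i, Complex.normSq (ψ i)) = 1) :
    star ψ ⬝ᵥ (((a₀ : ℂ) • (1 : Matrix (Fin 2) (Fin 2) ℂ) + dotPauli a).mulVec ψ)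
      = ((a₀ + ⟪a, n⟫ : ℝ) : ℂ) := by
  have e1 := congrFun hψ 0
  have e2 := congrFun hψ 1
  simp only [dotPauli, pauli, Matrix.mulVec, dotProduct, Fin.sum_univ_two, Fin.sum_univ_three,
    Matrix.add_apply, Matrix.smul_apply, smul_eq_mul, Matrix.of_apply, Matrix.cons_val',
    Matrix.cons_val_zero, Matrix.cons_val_one, Matrix.cons_val_fin_one, mul_zero, mul_one,
    add_zero, zero_add] at e1 e2
  have c1 := congrArg (starRingEnd ℂ) e1
  have c2 := congrArg (starRingEnd ℂ) e2
  simp only [map_add, map_mul, map_neg, Complex.conj_ofReal, Complex.conj_I, map_one] at c1 c2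
  have hN : (starRingEnd ℂ) (ψ 0) * ψ 0 + (starRingEnd ℂ) (ψ 1) * ψ 1 = 1 := by
    rw [← Complex.normSq_eq_conj_mul_self, ← Complex.normSq_eq_conj_mul_self]
    rw [Fin.sum_univ_two] at hnorm
    exact_mod_cast hnorm
  have hinner : (⟪a, n⟫ : ℝ) = a 0 * n 0 + a 1 * n 1 + a 2 * n 2 := by
    simp [PiLp.inner_apply, Fin.sum_univ_three, mul_comm]
  rw [hinner]
  push_cast
  simp [dotPauli, pauli, Matrix.mulVec, dotProduct, Fin.sum_univ_two, Fin.sum_univ_three]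
  generalize (starRingEnd ℂ) (ψ 0) = X at *
  generalize (starRingEnd ℂ) (ψ 1) = Y at *
  generalize ψ 0 = x at *
  generalize ψ 1 = y at *
  have I2 := Complex.I_sq
  have m0 : X * y + Y * x = n 0 := by
    linear_combination (-1/2) * (Y * e1 + X * e2 + y * c1 + x * c2) + (n 0 : ℂ) * hN
  have m1 : -Complex.I * X * y + Complex.I * Y * x = n 1 := by
    linear_combination (-1/2) * Complex.I * (Y * e1 - X * e2 - y * c1 + x * c2) + (n 1 : ℂ) * hN
      - (n 1 : ℂ) * (X * x + Y * y) * I2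
  have m2 : X * x - Y * y = n 2 := by
    linear_combination (-1/2) * (X * e1 - Y * e2 + x * c1 - y * c2) + (n 2 : ℂ) * hN
  linear_combination (a₀ : ℂ) * hN + (a 0 : ℂ) * m0 + (a 1 : ℂ) * m1 + (a 2 : ℂ) * m2

theorem bell_hv_model (a₀ : ℝ) (a n : EuclideanSpace ℝ (Fin 3)) (hn : ‖n‖ = 1) :
    ((4 * Real.pi)⁻¹ * ∫ l, v a₀ a n l ∂μS = a₀ + ⟪a, n⟫) ∧
    ∀ ψ : Fin 2 → ℂ,
      (dotPauli n).mulVec ψ = ψ → (∑ i, Complex.normSq (ψ i)) = 1 →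
      star ψ ⬝ᵥ (((a₀ : ℂ) • (1 : Matrix (Fin 2) (Fin 2) ℂ) + dotPauli a).mulVec ψ)
        = ((a₀ + ⟪a, n⟫ : ℝ) : ℂ) := by
  refine ⟨?_, expectation_of_dotPauli_eigenvector a₀ a n⟩
  rw [integral_v a₀ a n hn, inv_mul_cancel_left₀ (by positivity)]

end
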